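/- The infimum, over all nonzero F ∈ 𝒜, of the ratio max{‖𝓗(F)‖_{L∞(ℝ)}, ‖𝓗(f_F)‖_{L∞(ℝ/ℤ)}} / ‖F‖_{L¹(ℝ)} equals 1. -/

import Mathlib

open MeasureTheory

/-- `e t = e^{2πit}`. -/
noncomputable def e (t : ℝ) : ℂ := Complex.exp (2 * Real.pi * Complex.I * t)

/-- Fourier transform `F̂(t) = ∫ F(x) e^{-2πitx} dx`. -/
noncomputable def FT (F : ℝ → ℝ) (t : ℝ) : ℂ :=
  ∫ x : ℝ, (F x : ℂ) * Complex.exp (-(2 * Real.pi * Complex.I) * t * x)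

/-- Hilbert transform on `ℝ` via the multiplier `-i sgn(t)` and Fourier inversion. -/
noncomputable def HilbR (F : ℝ → ℝ) (x : ℝ) : ℂ :=
  ∫ t : ℝ, -Complex.I * (Real.sign t : ℂ) * FT F t * Complex.exp (2 * Real.pi * Complex.I * t * x)

/-- Hilbert transform on `ℝ/ℤ` of the periodization of `F_δ`, via the multiplier `-i sgn(k)`. -/
noncomputable def HilbPer (F : ℝ → ℝ) (δ : ℝ) (θ : ℝ) : ℂ :=
  ∑' k : ℤ, -Complex.I * (Int.sign k : ℂ) * FT F (δ * k) *
    Complex.exp (2 * Real.pi * Complex.I * k * θ)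

/-- The class `𝒜`: even, continuous, nonnegative, supported in `[-1/2,1/2]`, with `F̂ ∈ L¹`. -/
def memA (F : ℝ → ℝ) : Prop :=
  Continuous F ∧ (∀ x, F (-x) = F x) ∧ (∀ x, 0 ≤ F x) ∧
    (∀ x : ℝ, x ∉ Set.Icc (-(1/2) : ℝ) (1/2) → F x = 0) ∧
    MeasureTheory.Integrable (FT F)

/-- `‖𝓗(F)‖_{L^∞(ℝ)}` (sup norm of a bounded continuous function). -/
noncomputable def supHR (F : ℝ → ℝ) : ℝ := ⨆ x : ℝ, ‖HilbR F x‖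

/-- `‖𝓗(f_δ)‖_{L^∞(ℝ/ℤ)}` (sup norm of a bounded continuous function). -/
noncomputable def supHPer (F : ℝ → ℝ) (δ : ℝ) : ℝ := ⨆ θ : ℝ, ‖HilbPer F δ θ‖

/-- `𝒞(F) = max{‖𝓗(F)‖_{L∞(ℝ)}, ‖𝓗(f_F)‖_{L∞(ℝ/ℤ)}}`. -/
noncomputable def CF (F : ℝ → ℝ) : ℝ := max (supHR F) (supHPer F 1)

open Filter Topology

/-- The conjugate Poisson kernel, times `π`. -/
noncomputable def Qk (ε u : ℝ) : ℝ := u / (u ^ 2 + ε ^ 2)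

lemma Qk_eq_re (ε u : ℝ) : Qk ε u = (1 / ((u : ℂ) + ε * Complex.I)).re := by
  simp [Qk, Complex.normSq_apply, sq]

lemma Qk_neg (ε u : ℝ) : Qk ε (-u) = - Qk ε u := by
  simp [Qk, neg_div]

lemma Qk_continuous {ε : ℝ} (hε : 0 < ε) : Continuous (Qk ε) := by
  unfold Qk
  exact continuous_id.div (by fun_prop) (fun x => by positivity)

lemma Qk_abs_le {ε : ℝ} (hε : 0 < ε) (u : ℝ) : |Qk ε u| ≤ 1 / ε := by
  unfold Qk
  rw [abs_div, abs_of_pos (by positivity : 0 < u ^ 2 + ε ^ 2), div_le_div_iff₀ (by positivity) hε]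
  rw [← sq_abs u]
  nlinarith [sq_nonneg (|u| - ε), abs_nonneg u]

lemma integrable_exp_abs {c : ℝ} (hc : 0 < c) : Integrable (fun t : ℝ => Real.exp (-c * |t|)) := by
  rw [← integrableOn_univ, ← Set.Iic_union_Ioi (a := (0:ℝ))]
  apply IntegrableOn.union
  · refine (integrableOn_exp_mul_Iic hc 0).congr_fun ?_ measurableSet_Iic
    intro t ht
    simp only [Set.mem_Iic] at ht
    simp [abs_of_nonpos ht]
  · refine (integrableOn_exp_mul_Ioi (neg_lt_zero.2 hc) 0).congr_fun ?_ measurableSet_Ioi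
    intro t ht
    simp only [Set.mem_Ioi] at ht
    simp [abs_of_pos ht]

lemma kern_int {ε : ℝ} (hε : 0 < ε) (u : ℝ) :
    ∫ t : ℝ, -Complex.I * (Real.sign t : ℂ) * Complex.exp (2 * Real.pi * Complex.I * t * u)
      * Real.exp (-(2 * Real.pi * ε) * |t|) = ((Qk ε u / Real.pi : ℝ) : ℂ) := by
  have hpi := Real.pi_pos
  set g : ℝ → ℂ := fun t => -Complex.I * (Real.sign t : ℂ) *
    Complex.exp (2 * Real.pi * Complex.I * t * u) * Real.exp (-(2 * Real.pi * ε) * |t|) with hg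
  set a : ℂ := 2 * Real.pi * Complex.I * (u + ε * Complex.I) with ha
  set b : ℂ := 2 * Real.pi * Complex.I * (u - ε * Complex.I) with hb
  have ha' : a.re < 0 := by
    simp [ha]; positivity
  have hb' : 0 < b.re := by
    simp [hb]; positivity
  have h1 : Set.EqOn g (fun t : ℝ => -Complex.I * Complex.exp (a * t)) (Set.Ioi 0) := by
    intro t ht
    simp only [Set.mem_Ioi] at ht
    simp only [hg, Real.sign_of_pos ht, abs_of_pos ht, Complex.ofReal_exp, mul_assoc]
    simp only [← mul_assoc, Complex.ofReal_one, mul_one]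
    rw [mul_assoc, ← Complex.exp_add]
    congr 2
    simp only [ha]; push_cast; ring_nf; simp; ring
  have h2 : Set.EqOn g (fun t : ℝ => Complex.I * Complex.exp (b * t)) (Set.Iio 0) := by
    intro t ht
    simp only [Set.mem_Iio] at ht
    simp only [hg, Real.sign_of_neg ht, abs_of_neg ht, Complex.ofReal_exp]
    push_cast
    rw [mul_assoc, ← Complex.exp_add]
    have : -Complex.I * -1 = Complex.I := by ring
    rw [this]
    congr 2
    simp only [hb]; ring_nf; simp
  have i1 : IntegrableOn g (Set.Ioi 0) :=
    IntegrableOn.congr_fun ((integrableOn_exp_mul_complex_Ioi ha' 0).const_mul _) h1.symm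
      measurableSet_Ioi
  have i2 : IntegrableOn g (Set.Iic 0) := by
    rw [integrableOn_Iic_iff_integrableOn_Iio]
    exact IntegrableOn.congr_fun (((integrableOn_exp_mul_complex_Iic hb' 0).mono_set
      Set.Iio_subset_Iic_self).const_mul _) h2.symm measurableSet_Iio
  rw [← intervalIntegral.integral_Iic_add_Ioi i2 i1, integral_Iic_eq_integral_Iio,
    setIntegral_congr_fun measurableSet_Ioi h1, setIntegral_congr_fun measurableSet_Iio h2,
    integral_const_mul, integral_const_mul, integral_exp_mul_complex_Ioi ha',
    ← integral_Iic_eq_integral_Iio, integral_exp_mul_complex_Iic hb']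
  have hne : ((u:ℂ) ^ 2 + ε ^ 2) ≠ 0 := by
    have : u ^ 2 + ε ^ 2 ≠ 0 := by positivity
    exact_mod_cast this
  have hf : ((u:ℂ) ^ 2 + ε ^ 2) = (u + ε * Complex.I) * (u - ε * Complex.I) := by
    ring_nf; simp
  have hA : (u + ε * Complex.I : ℂ) ≠ 0 := fun h => hne (by rw [hf, h, zero_mul])
  have hB : (u - ε * Complex.I : ℂ) ≠ 0 := fun h => hne (by rw [hf, h, mul_zero])
  have hpc : (Real.pi : ℂ) ≠ 0 := by exact_mod_cast hpi.ne'
  simp only [Qk, ha, hb]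
  push_cast
  rw [hf]
  simp only [mul_zero, Complex.exp_zero]
  have hu : (u : ℂ) / ((u + ε * Complex.I) * (u - ε * Complex.I)) =
      (((u + ε * Complex.I) + (u - ε * Complex.I)) / 2) /
        ((u + ε * Complex.I) * (u - ε * Complex.I)) := by
    congr 1; ring
  rw [hu]
  generalize (u + ε * Complex.I : ℂ) = A at *
  generalize (u - ε * Complex.I : ℂ) = B at *
  field_simp

/-- Abel-regularised Hilbert transform. -/
noncomputable def HA (F : ℝ → ℝ) (x ε : ℝ) : ℂ :=
  ∫ t : ℝ, -Complex.I * (Real.sign t : ℂ) * FT F t * Complex.exp (2 * Real.pi * Complex.I * t * x)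
    * Real.exp (-(2 * Real.pi * ε) * |t|)

lemma measurable_sign : Measurable Real.sign := by
  unfold Real.sign
  exact Measurable.ite measurableSet_Iio measurable_const
    (Measurable.ite measurableSet_Ioi measurable_const measurable_const)

lemma norm_sign_le (t : ℝ) : ‖(Real.sign t : ℂ)‖ ≤ 1 := by
  rcases Real.sign_apply_eq t with h | h | h <;> simp [h]

lemma norm_e1 (t x : ℝ) : ‖Complex.exp (2 * Real.pi * Complex.I * t * x)‖ = 1 := by
  have : (2 * Real.pi * Complex.I * t * x : ℂ) = ((2 * Real.pi * t * x : ℝ) : ℂ) * Complex.I := by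
    push_cast; ring
  rw [this, Complex.norm_exp_ofReal_mul_I]

lemma HA_eq {F : ℝ → ℝ} (hF : Integrable F) {ε : ℝ} (hε : 0 < ε) (x : ℝ) :
    HA F x ε = ((∫ y, F y * (Qk ε (x - y) / Real.pi) : ℝ) : ℂ) := by
  have hpi := Real.pi_pos
  set g : ℝ → ℝ → ℂ := fun t y => (F y : ℂ) * (-Complex.I * (Real.sign t : ℂ) *
    Complex.exp (2 * Real.pi * Complex.I * t * (x - y : ℝ)) * Real.exp (-(2 * Real.pi * ε) * |t|))
    with hg
  have h1 : HA F x ε = ∫ t : ℝ, ∫ y : ℝ, g t y := by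
    unfold HA
    congr 1; ext t
    unfold FT
    rw [mul_comm, ← mul_assoc, mul_comm, ← integral_const_mul, ← integral_const_mul,
      ← integral_const_mul]
    congr 1; ext y
    simp only [hg]
    have : Complex.exp (2 * Real.pi * Complex.I * t * (x - y : ℝ)) =
      Complex.exp (2 * Real.pi * Complex.I * t * x) *
        Complex.exp (-(2 * Real.pi * Complex.I) * t * y) := by
      rw [← Complex.exp_add]; congr 1; push_cast; ring
    rw [this]; ring
  have hprodInt : Integrable (Function.uncurry g) (volume.prod volume) := by
    have hb : Integrable (fun p : ℝ × ℝ => Real.exp (-(2 * Real.pi * ε) * |p.1|) * F p.2)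
        (volume.prod volume) := (integrable_exp_abs (by positivity)).mul_prod hF
    refine hb.mono ?_ ?_
    · refine AEStronglyMeasurable.mul ?_ ?_
      · exact (Complex.continuous_ofReal.comp_aestronglyMeasurable
          hF.aestronglyMeasurable.comp_snd)
      · apply Measurable.aestronglyMeasurable
        have := measurable_sign
        refine Measurable.mul (Measurable.mul (Measurable.mul measurable_const ?_) ?_) ?_
        · exact Complex.measurable_ofReal.comp (this.comp measurable_fst)
        · apply Continuous.measurable; fun_prop
        · apply Continuous.measurable; fun_prop
    · refine ae_of_all _ fun p => ?_
      simp only [Function.uncurry, hg, norm_mul, norm_e1, norm_neg, Complex.norm_I, one_mul, mul_one,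
        Complex.norm_real]
      have := norm_sign_le p.1
      rw [Complex.norm_real] at this
      calc _ ≤ ‖F p.2‖ * (1 * ‖Real.exp (-(2 * Real.pi * ε) * |p.1|)‖) := by gcongr
        _ = _ := by ring
  rw [h1, integral_integral_swap hprodInt, ← integral_complex_ofReal]
  congr 1; ext y
  simp only [hg]
  rw [integral_const_mul, kern_int hε]
  push_cast; ring

lemma HA_zero (F : ℝ → ℝ) (x : ℝ) : HA F x 0 = HilbR F x := by
  simp [HA, HilbR]

lemma HA_norm_le {F : ℝ → ℝ} (hF : Integrable (FT F)) {ε : ℝ} (hε : 0 ≤ ε) (x : ℝ) :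
    ‖HA F x ε‖ ≤ ∫ t, ‖FT F t‖ := by
  refine norm_integral_le_of_norm_le hF.norm (ae_of_all _ fun t => ?_)
  have h0 : Real.exp (-(2 * Real.pi * ε) * |t|) ≤ 1 := by
    rw [Real.exp_le_one_iff, neg_mul, neg_nonpos]
    have := Real.pi_pos
    positivity
  simp only [norm_mul, norm_e1, norm_neg, Complex.norm_I, one_mul, mul_one]
  rw [Complex.norm_real (Real.exp _), Real.norm_eq_abs (Real.exp _), Real.abs_exp]
  calc _ ≤ 1 * ‖FT F t‖ * 1 := by gcongr; exact norm_sign_le t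
    _ = _ := by ring

lemma HA_tendsto' {F : ℝ → ℝ} (hF : Integrable (FT F)) {ι : Type*} {l : Filter ι}
    [l.IsCountablyGenerated] {xs es : ι → ℝ} {x : ℝ} (hx : Tendsto xs l (𝓝 x))
    {ε : ℝ} (he : Tendsto es l (𝓝 ε)) (hpos : ∀ᶠ i in l, 0 ≤ es i) :
    Tendsto (fun i => HA F (xs i) (es i)) l (𝓝 (HA F x ε)) := by
  unfold HA
  refine tendsto_integral_filter_of_dominated_convergence (fun t => ‖FT F t‖) ?_ ?_ hF.norm ?_
  · refine Eventually.of_forall fun i => ?_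
    refine AEStronglyMeasurable.mul (AEStronglyMeasurable.mul (AEStronglyMeasurable.mul ?_
      hF.aestronglyMeasurable) ?_) ?_
    · exact (measurable_const.mul
        (Complex.measurable_ofReal.comp measurable_sign)).aestronglyMeasurable
    · apply Continuous.aestronglyMeasurable; fun_prop
    · apply Continuous.aestronglyMeasurable; fun_prop
  · filter_upwards [hpos] with i hi
    refine ae_of_all _ fun t => ?_
    have h0 : Real.exp (-(2 * Real.pi * es i) * |t|) ≤ 1 := by
      rw [Real.exp_le_one_iff, neg_mul, neg_nonpos]
      have := Real.pi_pos
      positivity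
    simp only [norm_mul, norm_e1, norm_neg, Complex.norm_I, one_mul, mul_one]
    rw [Complex.norm_real (Real.exp _), Real.norm_eq_abs (Real.exp _), Real.abs_exp]
    calc _ ≤ 1 * ‖FT F t‖ * 1 := by gcongr; exact norm_sign_le t
      _ = _ := by ring
  · refine ae_of_all _ fun t => ?_
    refine Tendsto.mul (Tendsto.mul tendsto_const_nhds ?_) ?_
    · have : Continuous fun x : ℝ => Complex.exp (2 * Real.pi * Complex.I * t * x) := by fun_prop
      exact (this.tendsto x).comp hx
    · have : Continuous fun x : ℝ => (Real.exp (-(2 * Real.pi * x) * |t|) : ℂ) := by fun_prop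
      exact (this.tendsto ε).comp he

lemma HA_tendsto {F : ℝ → ℝ} (hF : Integrable (FT F)) {ι : Type*} {l : Filter ι}
    [l.IsCountablyGenerated] {xs es : ι → ℝ} {x : ℝ} (hx : Tendsto xs l (𝓝 x))
    (he : Tendsto es l (𝓝 0)) (hpos : ∀ᶠ i in l, 0 ≤ es i) :
    Tendsto (fun i => HA F (xs i) (es i)) l (𝓝 (HilbR F x)) := by
  rw [← HA_zero]
  exact HA_tendsto' hF hx he hpos

lemma HA_continuous {F : ℝ → ℝ} (hF : Integrable (FT F)) {xs es : ℝ → ℝ} (hx : Continuous xs)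
    (he : Continuous es) (hpos : ∀ i, 0 ≤ es i) : Continuous (fun i => HA F (xs i) (es i)) :=
  continuous_iff_continuousAt.2 fun i => HA_tendsto' hF (hx.tendsto i) (he.tendsto i)
    (Eventually.of_forall hpos)

lemma D_ne {y : ℝ} (hy : |y| ≤ 1/2) {u : ℂ} (hu : ‖u‖ < 1) : (1 - 4 * y * u + u ^ 2 : ℂ) ≠ 0 := by
  intro h
  obtain ⟨hy1, hy2⟩ := abs_le.1 hy
  have hn : u.re ^ 2 + u.im ^ 2 < 1 := by
    have := Complex.sq_norm u
    rw [Complex.normSq_apply] at this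
    nlinarith [norm_nonneg u]
  have hre := congrArg Complex.re h
  have him := congrArg Complex.im h
  simp [sq] at hre him
  have him' : u.im * (u.re - 2 * y) = 0 := by linarith
  rcases mul_eq_zero.1 him' with h0 | h0
  · rw [h0] at hre hn
    have h1 : -1 < u.re := by nlinarith
    have h2 : u.re < 1 := by nlinarith
    rcases le_total 0 u.re with h3 | h3
    · nlinarith [mul_nonneg h3 (by linarith : 0 ≤ 1/2 - y), sq_pos_of_pos (by linarith : 0 < 1 - u.re)]
    · nlinarith [mul_nonneg (neg_nonneg.2 h3) (by linarith : 0 ≤ 1/2 + y),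
        sq_pos_of_pos (by linarith : 0 < 1 + u.re)]
  · have : u.re = 2 * y := by linarith
    nlinarith

/-- abscissa of the ellipse -/
noncomputable def Xr (r φ : ℝ) : ℝ := (r + 1 / r) * Real.cos φ / 4
/-- ordinate of the ellipse -/
noncomputable def Er (r φ : ℝ) : ℝ := (r - 1 / r) * Real.sin φ / 4

lemma Qk_abs (ε u : ℝ) : Qk |ε| u = Qk ε u := by simp [Qk]

lemma XE_eq {r : ℝ} (hr : 0 < r) (φ y : ℝ) :
    ((Xr r φ - y : ℝ) : ℂ) + (Er r φ : ℝ) * Complex.I =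
      (1 - 4 * y * (circleMap 0 r φ) + (circleMap 0 r φ) ^ 2) / (4 * circleMap 0 r φ) := by
  have hrc : (r : ℂ) ≠ 0 := by exact_mod_cast hr.ne'
  have h0 : circleMap 0 r φ ≠ 0 := by
    simp [circleMap, hr.ne']
  have hinv : (circleMap 0 r φ)⁻¹ = (1 / r) * (Real.cos φ - Real.sin φ * Complex.I) := by
    simp only [circleMap, zero_add, mul_inv, ← Complex.exp_neg]
    rw [← neg_mul, Complex.exp_mul_I, Complex.cos_neg, Complex.sin_neg]
    push_cast; ring
  have hc : circleMap 0 r φ = r * (Real.cos φ + Real.sin φ * Complex.I) := by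
    simp [circleMap, Complex.exp_mul_I]
  have : (1 - 4 * y * (circleMap 0 r φ) + (circleMap 0 r φ) ^ 2) / (4 * circleMap 0 r φ) =
      (circleMap 0 r φ + (circleMap 0 r φ)⁻¹) / 4 - y := by
    field_simp; ring
  rw [this, hinv, hc]
  simp only [Xr, Er]; push_cast
  ring

lemma mv {r y : ℝ} (hr : 0 < r) (hr1 : r < 1) (hy : |y| ≤ 1/2) :
    ∫ φ in (0:ℝ)..2 * Real.pi, Qk (Er r φ) (Xr r φ - y) * Real.cos φ = 4 * Real.pi * r := by
  set g : ℂ → ℂ := fun u => 2 * (u ^ 2 / r + r) / (1 - 4 * y * u + u ^ 2) with hg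
  have hrc : (r : ℂ) ≠ 0 := by exact_mod_cast hr.ne'
  have hD : ∀ φ, (1 - 4 * y * (circleMap 0 r φ) + (circleMap 0 r φ) ^ 2) ≠ 0 := fun φ =>
    D_ne hy (by simp [abs_of_pos hr, hr1])
  have hpt : ∀ φ, Qk (Er r φ) (Xr r φ - y) * Real.cos φ = (g (circleMap 0 r φ)).re := by
    intro φ
    have h0 : circleMap 0 r φ ≠ 0 := by simp [circleMap, hr.ne']
    have hcos : (Real.cos φ : ℂ) = (circleMap 0 r φ / r + r * (circleMap 0 r φ)⁻¹) / 2 := by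
      simp only [circleMap, zero_add, mul_inv, ← Complex.exp_neg, Complex.ofReal_cos, Complex.cos]
      field_simp
    rw [Qk_eq_re, XE_eq hr, ← Complex.re_mul_ofReal, hcos]
    congr 1
    simp only [hg]
    have := hD φ
    generalize circleMap 0 r φ = u at *
    field_simp
    try ring
  have hdiff : DiffContOnCl ℂ g (Metric.ball 0 |r|) := by
    apply DifferentiableOn.diffContOnCl
    have hsub : closure (Metric.ball (0:ℂ) |r|) ⊆ Metric.ball 0 1 := by
      refine Metric.closure_ball_subset_closedBall.trans ?_
      apply Metric.closedBall_subset_ball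
      rwa [abs_of_pos hr]
    refine DifferentiableOn.mono ?_ hsub
    refine DifferentiableOn.div (by fun_prop) (by fun_prop) ?_
    intro u hu
    exact D_ne hy (by simpa using hu)
  have hav := hdiff.circleAverage
  rw [Real.circleAverage_def] at hav
  have hcont : Continuous fun φ => g (circleMap 0 r φ) := by
    simp only [hg]
    refine Continuous.div (by fun_prop) (by fun_prop) hD
  simp_rw [hpt]
  have hre : ∫ φ in (0:ℝ)..2 * Real.pi, (g (circleMap 0 r φ)).re =
      (∫ φ in (0:ℝ)..2 * Real.pi, g (circleMap 0 r φ)).re := by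
    have := Complex.reCLM.intervalIntegral_comp_comm (hcont.intervalIntegrable (μ := volume) 0 (2 * Real.pi))
    simpa using this
  have h2 : ∫ φ in (0:ℝ)..2 * Real.pi, g (circleMap 0 r φ) = ((4 * Real.pi * r : ℝ) : ℂ) := by
    have hpi : (Real.pi : ℂ) ≠ 0 := by exact_mod_cast Real.pi_pos.ne'
    rw [inv_smul_eq_iff₀ (by positivity)] at hav
    rw [hav]
    simp [hg]; ring
  rw [hre, h2, Complex.ofReal_re]

lemma integral_abs_cos : ∫ φ in (0:ℝ)..2 * Real.pi, |Real.cos φ| = 4 := by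
  have hpi := Real.pi_pos
  have hi : ∀ a b, IntervalIntegrable (fun φ => |Real.cos φ|) volume a b := fun a b =>
    (Real.continuous_cos.abs).intervalIntegrable a b
  rw [← intervalIntegral.integral_add_adjacent_intervals (hi 0 (Real.pi/2)) (hi _ _),
    ← intervalIntegral.integral_add_adjacent_intervals (hi (Real.pi/2) (Real.pi + Real.pi/2)) (hi _ _)]
  have h1 : ∫ φ in (0:ℝ)..(Real.pi/2), |Real.cos φ| = ∫ φ in (0:ℝ)..(Real.pi/2), Real.cos φ := by
    apply intervalIntegral.integral_congr
    intro x hx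
    rw [Set.uIcc_of_le (by linarith)] at hx
    exact abs_of_nonneg (Real.cos_nonneg_of_mem_Icc ⟨by linarith [hx.1], hx.2⟩)
  have h2 : ∫ φ in (Real.pi/2)..(Real.pi + Real.pi/2), |Real.cos φ| =
      ∫ φ in (Real.pi/2)..(Real.pi + Real.pi/2), -Real.cos φ := by
    apply intervalIntegral.integral_congr
    intro x hx
    rw [Set.uIcc_of_le (by linarith)] at hx
    exact abs_of_nonpos (Real.cos_nonpos_of_pi_div_two_le_of_le hx.1 hx.2)
  have h3 : ∫ φ in (Real.pi + Real.pi/2)..(2 * Real.pi), |Real.cos φ| =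
      ∫ φ in (Real.pi + Real.pi/2)..(2 * Real.pi), Real.cos φ := by
    apply intervalIntegral.integral_congr
    intro x hx
    rw [Set.uIcc_of_le (by linarith)] at hx
    simp only
    rw [← Real.cos_sub_two_pi]
    exact abs_of_nonneg (Real.cos_nonneg_of_mem_Icc ⟨by linarith [hx.1], by linarith [hx.2]⟩)
  rw [h1, h2, h3, intervalIntegral.integral_neg, integral_cos, integral_cos, integral_cos]
  simp only [Real.sin_pi_div_two, Real.sin_zero, Real.sin_two_pi, Real.sin_add, Real.sin_pi,
    Real.cos_pi]
  norm_num

lemma J_eq {F : ℝ → ℝ} (hF : memA F) {r : ℝ} (hr : 0 < r) (hr1 : r < 1) :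
    ∫ φ in (0:ℝ)..2 * Real.pi, (HA F (Xr r φ) |Er r φ|).re * Real.cos φ = 4 * r * ∫ y, F y := by
  obtain ⟨hc, he, hn, hs, hFT⟩ := hF
  have hpi := Real.pi_pos
  have hsupp : HasCompactSupport F := HasCompactSupport.intro isCompact_Icc hs
  have hFi : Integrable F := hc.integrable_of_hasCompactSupport hsupp
  have hIcc : ∀ g : ℝ → ℝ, ∫ y, F y * g y = ∫ y in Set.Icc (-(1/2):ℝ) (1/2), F y * g y := by
    intro g
    rw [setIntegral_eq_integral_of_forall_compl_eq_zero]
    intro y hy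
    rw [hs y hy, zero_mul]
  have h1 : ∫ φ in (0:ℝ)..2 * Real.pi, (HA F (Xr r φ) |Er r φ|).re * Real.cos φ =
      ∫ φ in (0:ℝ)..2 * Real.pi, ∫ y in Set.Icc (-(1/2):ℝ) (1/2),
        F y * (Qk (Er r φ) (Xr r φ - y) * Real.cos φ / Real.pi) := by
    apply intervalIntegral.integral_congr_ae
    have hcount : {φ : ℝ | Real.sin φ = 0}.Countable := by
      have : {φ : ℝ | Real.sin φ = 0} ⊆ Set.range (fun n : ℤ => (n : ℝ) * Real.pi) := by
        intro φ hφ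
        exact Real.sin_eq_zero_iff.1 hφ
      exact (Set.countable_range _).mono this
    filter_upwards [hcount.ae_notMem volume] with φ hφ _
    have hE : Er r φ ≠ 0 := by
      unfold Er
      have : r - 1 / r ≠ 0 := by
        have : 1 < 1 / r := by rw [lt_div_iff₀ hr]; linarith
        linarith
      have h' : Real.sin φ ≠ 0 := hφ
      positivity
    rw [HA_eq hFi (abs_pos.2 hE), Complex.ofReal_re, hIcc, ← integral_mul_const]
    congr 1; ext y
    rw [Qk_abs]; ring
  have hprodInt : Integrable (Function.uncurry fun φ y => F y * (Qk (Er r φ) (Xr r φ - y) * Real.cos φ / Real.pi))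
      ((volume.restrict (Set.uIoc 0 (2 * Real.pi))).prod (volume.restrict (Set.Icc (-(1/2):ℝ) (1/2)))) := by
    rw [Measure.prod_restrict]
    have : IntegrableOn (Function.uncurry fun φ y => F y * (Qk (Er r φ) (Xr r φ - y) * Real.cos φ / Real.pi))
        (Set.Icc 0 (2 * Real.pi) ×ˢ Set.Icc (-(1/2):ℝ) (1/2)) (volume.prod volume) := by
      apply ContinuousOn.integrableOn_compact (isCompact_Icc.prod isCompact_Icc)
      simp only [Function.uncurry_def, Qk, Xr, Er]
      refine ContinuousOn.mul (by fun_prop) (ContinuousOn.div_const (ContinuousOn.mul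
        (ContinuousOn.div (by fun_prop) (by fun_prop) ?_) (by fun_prop)) _)
      rintro ⟨φ, y⟩ ⟨-, hy⟩
      simp only at hy ⊢
      have hD : (1 - 4 * y * (circleMap 0 r φ) + (circleMap 0 r φ) ^ 2) ≠ 0 :=
        D_ne (abs_le.2 hy) (by simp [abs_of_pos hr, hr1])
      have h0 : circleMap 0 r φ ≠ 0 := by simp [circleMap, hr.ne']
      have h3 : ((Xr r φ - y : ℝ) : ℂ) + (Er r φ : ℝ) * Complex.I ≠ 0 := by
        rw [XE_eq hr]
        exact div_ne_zero hD (mul_ne_zero (by norm_num) h0)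
      intro h4
      apply h3
      rw [← Complex.normSq_eq_zero, Complex.normSq_add_mul_I]
      exact h4
    refine this.mono_set (Set.prod_mono ?_ le_rfl)
    rw [Set.uIoc_of_le (by positivity)]
    exact Set.Ioc_subset_Icc_self
  rw [h1, intervalIntegral_integral_swap hprodInt]
  have h2 : ∀ y ∈ Set.Icc (-(1/2):ℝ) (1/2), ∫ φ in (0:ℝ)..2 * Real.pi,
      F y * (Qk (Er r φ) (Xr r φ - y) * Real.cos φ / Real.pi) = F y * (4 * r) := by
    intro y hy
    rw [intervalIntegral.integral_const_mul, intervalIntegral.integral_div,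
      mv hr hr1 (abs_le.2 hy)]
    field_simp
  rw [setIntegral_congr_fun measurableSet_Icc h2, ← hIcc fun _ => 4 * r, integral_mul_const]
  ring

lemma HilbR_le_sup {F : ℝ → ℝ} (hF : Integrable (FT F)) (x : ℝ) : ‖HilbR F x‖ ≤ supHR F := by
  refine le_ciSup (f := fun x => ‖HilbR F x‖) ⟨∫ t, ‖FT F t‖, ?_⟩ x
  rintro _ ⟨x, rfl⟩
  simp only
  rw [← HA_zero]
  exact HA_norm_le hF le_rfl x

lemma lower {F : ℝ → ℝ} (hF : memA F) : ∫ y, F y ≤ supHR F := by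
  have hFT : Integrable (FT F) := hF.2.2.2.2
  have hpi := Real.pi_pos
  have hlim : Tendsto (fun r : ℝ => ∫ φ in (0:ℝ)..2 * Real.pi, (HA F (Xr r φ) |Er r φ|).re * Real.cos φ)
      (𝓝[<] 1) (𝓝 (∫ φ in (0:ℝ)..2 * Real.pi, (HilbR F (Real.cos φ / 2)).re * Real.cos φ)) := by
    refine intervalIntegral.tendsto_integral_filter_of_dominated_convergence
      (fun _ => ∫ t, ‖FT F t‖) ?_ ?_ intervalIntegrable_const ?_
    · refine Eventually.of_forall fun r => Continuous.aestronglyMeasurable ?_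
      refine (Complex.continuous_re.comp (HA_continuous hFT ?_ ?_ ?_)).mul Real.continuous_cos
      · unfold Xr; fun_prop
      · unfold Er; fun_prop
      · intro i; positivity
    · refine Eventually.of_forall fun r => ae_of_all _ fun φ _ => ?_
      rw [norm_mul]
      calc _ ≤ ‖HA F (Xr r φ) |Er r φ|‖ * 1 := by
            gcongr
            · exact Complex.abs_re_le_norm _
            · exact Real.abs_cos_le_one φ
        _ ≤ _ := by rw [mul_one]; exact HA_norm_le hFT (abs_nonneg _) _
    · refine ae_of_all _ fun φ _ => ?_
      refine Tendsto.mul_const _ ((Complex.continuous_re.tendsto _).comp (HA_tendsto hFT ?_ ?_ ?_))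
      · have : ContinuousAt (fun r => Xr r φ) 1 := by
          unfold Xr; fun_prop (disch := norm_num)
        have h := this.tendsto.mono_left (nhdsWithin_le_nhds (s := Set.Iio 1))
        convert h using 2
        simp [Xr]; ring
      · have : ContinuousAt (fun r => |Er r φ|) 1 := by
          unfold Er; fun_prop (disch := norm_num)
        have h := this.tendsto.mono_left (nhdsWithin_le_nhds (s := Set.Iio 1))
        convert h using 2
        simp [Er]
      · exact Eventually.of_forall fun r => abs_nonneg _
  have hlim2 : Tendsto (fun r : ℝ => ∫ φ in (0:ℝ)..2 * Real.pi, (HA F (Xr r φ) |Er r φ|).re * Real.cos φ)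
      (𝓝[<] 1) (𝓝 (4 * 1 * ∫ y, F y)) := by
    have : Tendsto (fun r : ℝ => 4 * r * ∫ y, F y) (𝓝[<] 1) (𝓝 (4 * 1 * ∫ y, F y)) := by
      apply Tendsto.mono_left _ (nhdsWithin_le_nhds)
      apply Continuous.tendsto
      fun_prop
    refine this.congr' ?_
    filter_upwards [Ioo_mem_nhdsLT (show (0:ℝ) < 1 by norm_num)] with r hr
    exact (J_eq hF hr.1 hr.2).symm
  have heq := tendsto_nhds_unique hlim hlim2
  have hcont : Continuous fun φ => (HilbR F (Real.cos φ / 2)).re * Real.cos φ := by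
    simp_rw [← HA_zero]
    exact (Complex.continuous_re.comp (HA_continuous hFT (by fun_prop) continuous_const
      (fun _ => le_rfl))).mul Real.continuous_cos
  have hle : ∫ φ in (0:ℝ)..2 * Real.pi, (HilbR F (Real.cos φ / 2)).re * Real.cos φ ≤
      ∫ φ in (0:ℝ)..2 * Real.pi, supHR F * |Real.cos φ| := by
    refine intervalIntegral.integral_mono (by positivity) (hcont.intervalIntegrable _ _)
      ((continuous_const.mul Real.continuous_cos.abs).intervalIntegrable _ _) fun φ => ?_
    simp only
    calc _ ≤ |(HilbR F (Real.cos φ / 2)).re| * |Real.cos φ| := by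
          rw [← abs_mul]; exact le_abs_self _
      _ ≤ _ := by
          gcongr
          exact (Complex.abs_re_le_norm _).trans (HilbR_le_sup hFT _)
  rw [intervalIntegral.integral_const_mul, integral_abs_cos] at hle
  linarith
lemma arcs {v w : ℂ} (hw : 0 < w.re) (hvw : w ^ 2 = 1 - v ^ 2) :
    ∫ φ in (0:ℝ)..2 * Real.pi, 1 / (1 - v * Real.cos φ) = 2 * Real.pi / w := by
  have hw0 : w ≠ 0 := by rintro rfl; simp at hw
  have hw1 : 1 + w ≠ 0 := by
    intro h
    have := congrArg Complex.re h
    simp at this; linarith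
  obtain ⟨q, hq⟩ : ∃ q, q = v / (1 + w) := ⟨_, rfl⟩
  have hv : v = q * (1 + w) := by rw [hq]; field_simp
  have hq2 : q ^ 2 * (1 + w) = 1 - w := by
    apply mul_right_cancel₀ hw1
    rw [hv] at hvw
    linear_combination hvw
  have hqn : ‖q‖ < 1 := by
    have h1 : ‖1 - w‖ < ‖1 + w‖ := by
      rw [← sq_lt_sq₀ (norm_nonneg _) (norm_nonneg _), Complex.sq_norm, Complex.sq_norm,
        Complex.normSq_apply, Complex.normSq_apply]
      simp; nlinarith
    have h2 := congrArg norm hq2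
    rw [norm_mul, norm_pow] at h2
    by_contra hcon
    push Not at hcon
    have : 1 ≤ ‖q‖ ^ 2 := one_le_pow₀ hcon
    nlinarith [norm_nonneg (1 + w)]
  have hqq : 1 - q ^ 2 ≠ 0 := by
    intro h
    have : ‖q ^ 2‖ = 1 := by
      rw [← sub_eq_zero.1 h]; simp
    rw [norm_pow] at this
    nlinarith [norm_nonneg q]
  have hqu : ∀ u : ℂ, ‖u‖ ≤ 1 → 1 - q * u ≠ 0 := by
    intro u hu h
    have : ‖q * u‖ = 1 := by rw [← sub_eq_zero.1 h]; simp
    rw [norm_mul] at this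
    nlinarith [norm_nonneg q, norm_nonneg u]
  have hdiff : DiffContOnCl ℂ (fun u => (1 - q * u)⁻¹) (Metric.ball 0 1) := by
    apply DifferentiableOn.diffContOnCl
    rw [closure_ball _ one_ne_zero]
    refine DifferentiableOn.inv (by fun_prop) ?_
    intro u hu
    exact hqu u (by simpa using hu)
  have hc := hdiff.circleIntegral_sub_inv_smul (w := q) (by simpa using hqn)
  simp only [circleIntegral, deriv_circleMap, smul_eq_mul] at hc
  have hpt : ∀ φ : ℝ, 1 / (1 - v * Real.cos φ) = ((1 + q ^ 2) / Complex.I) *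
      (circleMap 0 1 φ * Complex.I * ((circleMap 0 1 φ - q)⁻¹ * (1 - q * circleMap 0 1 φ)⁻¹)) := by
    intro φ
    have h0 : circleMap 0 1 φ ≠ 0 := by simp [circleMap]
    have hn : ‖circleMap 0 1 φ‖ = 1 := by simp
    have hcos : (Real.cos φ : ℂ) = (circleMap 0 1 φ + (circleMap 0 1 φ)⁻¹) / 2 := by
      simp only [circleMap, zero_add, mul_inv, ← Complex.exp_neg, Complex.ofReal_cos, Complex.cos]
      simp
    rw [hcos]
    generalize circleMap 0 1 φ = u at *
    have h1 := hqu u hn.le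
    have h2 : u - q ≠ 0 := by
      intro h
      rw [sub_eq_zero.1 h] at hn
      linarith
    have hprod : (1 + q ^ 2) * (1 - v * ((u + u⁻¹) / 2)) = (1 - q * u) * ((u - q) / u) := by
      have : (1 + q ^ 2) * v = 2 * q := by
        rw [hv]; linear_combination q * hq2
      field_simp
      linear_combination (-(u ^ 2 + 1)) * this
    have h3 : (1 - v * ((u + u⁻¹) / 2)) ≠ 0 := by
      intro h
      rw [h, mul_zero] at hprod
      exact (mul_ne_zero h1 (div_ne_zero h2 h0)) hprod.symm
    rw [div_eq_iff h3]
    calc (1 : ℂ) = ((1 - q * u) * ((u - q) / u)) * (u * (u - q)⁻¹ * (1 - q * u)⁻¹) := by field_simp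
      _ = _ := by
        rw [← hprod]
        field_simp
  simp_rw [hpt]
  rw [intervalIntegral.integral_const_mul, hc]
  have h1w : 1 - q ^ 2 = w * (1 + q ^ 2) := by linear_combination (-1 : ℂ) * hq2
  have hq3 : 1 + q ^ 2 ≠ 0 := by
    intro h; rw [h, mul_zero] at h1w; exact hqq h1w
  rw [← pow_two, h1w]
  field_simp

lemma slit {v : ℂ} (h : v.im ≠ 0 ∨ v = 0) : 1 - v ^ 2 ∈ Complex.slitPlane := by
  rw [Complex.mem_slitPlane_iff]
  rcases h with h | h
  · by_cases hr : v.re = 0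
    · left
      simp [sq, hr]
      nlinarith [mul_self_nonneg v.im]
    · right
      simp [sq]
      intro h2
      have : v.re * v.im = 0 := by linarith
      rcases mul_eq_zero.1 this with h3 | h3
      · exact hr h3
      · exact h h3
  · left; simp [h]

/-- principal square root of `1 - v²` -/
noncomputable def wv (v : ℂ) : ℂ := Complex.exp (Complex.log (1 - v ^ 2) / 2)

lemma wv_sq {v : ℂ} (h : 1 - v ^ 2 ∈ Complex.slitPlane) : wv v ^ 2 = 1 - v ^ 2 := by
  unfold wv
  rw [← Complex.exp_nat_mul]
  have : ((2 : ℕ) : ℂ) * (Complex.log (1 - v ^ 2) / 2) = Complex.log (1 - v ^ 2) := by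
    push_cast; ring
  rw [this, Complex.exp_log (Complex.slitPlane_ne_zero h)]

lemma wv_re {v : ℂ} (h : 1 - v ^ 2 ∈ Complex.slitPlane) : 0 < (wv v).re := by
  unfold wv
  rw [Complex.exp_re]
  apply mul_pos (Real.exp_pos _)
  apply Real.cos_pos_of_mem_Ioo
  have h1 := Complex.neg_pi_lt_arg (1 - v ^ 2)
  have h2 := (Complex.arg_le_pi (1 - v ^ 2)).lt_of_ne (Complex.mem_slitPlane_iff_arg.1 h).1
  have : (Complex.log (1 - v ^ 2) / 2).im = (1 - v ^ 2).arg / 2 := by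
    rw [show (2 : ℂ) = ((2 : ℝ) : ℂ) by norm_num, Complex.div_ofReal_im, Complex.log_im]
  rw [this]
  constructor <;> linarith

lemma p_mul {v : ℂ} (h : 1 - v ^ 2 ∈ Complex.slitPlane) :
    (Complex.I * v + wv v) * (-(Complex.I * v) + wv v) = 1 := by
  have := wv_sq h
  have hI := Complex.I_sq
  linear_combination this - v ^ 2 * hI

lemma p_re {v : ℂ} (h : 1 - v ^ 2 ∈ Complex.slitPlane) : 0 < (Complex.I * v + wv v).re := by
  have h1 := p_mul h
  have h2 := wv_re h
  obtain ⟨p, hp⟩ : ∃ p, p = Complex.I * v + wv v := ⟨_, rfl⟩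
  have h3 : p⁻¹ = -(Complex.I * v) + wv v := by
    rw [hp]; exact inv_eq_of_mul_eq_one_right h1
  have h4 : (p + p⁻¹).re = 2 * (wv v).re := by
    rw [h3, hp]; simp; ring
  rw [← hp]
  rw [Complex.add_re, Complex.inv_re] at h4
  by_contra hcon
  push Not at hcon
  have : p.re / Complex.normSq p ≤ 0 := div_nonpos_of_nonpos_of_nonneg hcon (Complex.normSq_nonneg _)
  linarith

lemma p_im {v : ℂ} (h : 1 - v ^ 2 ∈ Complex.slitPlane) (hv : 0 ≤ v.re) :
    0 ≤ (Complex.I * v + wv v).im := by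
  have h1 := p_mul h
  obtain ⟨p, hp⟩ : ∃ p, p = Complex.I * v + wv v := ⟨_, rfl⟩
  have h3 : p⁻¹ = -(Complex.I * v) + wv v := by
    rw [hp]; exact inv_eq_of_mul_eq_one_right h1
  have h4 : (p - p⁻¹).im = 2 * v.re := by
    rw [h3, hp]; simp; ring
  rw [← hp]
  rw [Complex.sub_im, Complex.inv_im] at h4
  by_contra hcon
  push Not at hcon
  have : 0 ≤ -p.im / Complex.normSq p := div_nonneg (by linarith) (Complex.normSq_nonneg _)
  linarith

lemma stieltjes {a : ℝ} (ha : 0 < a) {z : ℂ} (hz : 0 < z.im) :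
    (2 * Real.pi : ℝ)⁻¹ • ∫ l in (0:ℝ)..1, ∫ φ in (0:ℝ)..2 * Real.pi,
      1 / (z - (a * l * Real.cos φ : ℝ)) =
      (-Complex.I / a) * Complex.log (Complex.I * (a / z) + wv (a / z)) := by
  have hz0 : z ≠ 0 := by rintro rfl; simp at hz
  have hac : (a : ℂ) ≠ 0 := by exact_mod_cast ha.ne'
  have hpc : (Real.pi : ℂ) ≠ 0 := by exact_mod_cast Real.pi_pos.ne'
  have hsl : ∀ l : ℝ, 1 - (a / z * l : ℂ) ^ 2 ∈ Complex.slitPlane := by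
    intro l
    apply slit
    by_cases hl : l = 0
    · right; simp [hl]
    · left
      have : (a / z * l : ℂ).im = - (a * l * z.im / Complex.normSq z) := by
        rw [Complex.im_mul_ofReal, div_eq_mul_inv, Complex.im_ofReal_mul, Complex.inv_im]
        ring
      rw [this]
      have := Complex.normSq_pos.2 hz0
      have := hz.ne'
      simp [hl, ha.ne', this, hz0]
  have hinner : ∀ l : ℝ, ∫ φ in (0:ℝ)..2 * Real.pi, 1 / (z - (a * l * Real.cos φ : ℝ)) =
      1 / z * (2 * Real.pi / wv (a / z * l)) := by
    intro l
    rw [← arcs (wv_re (hsl l)) (wv_sq (hsl l)), ← intervalIntegral.integral_const_mul]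
    congr 1; ext φ
    rw [div_mul_div_comm, one_mul]
    congr 1
    push_cast
    field_simp
  simp_rw [hinner]
  have hwne : ∀ l : ℝ, wv (a / z * l) ≠ 0 := fun l h => by
    have := wv_re (hsl l); rw [h] at this; simp at this
  have hwd : ∀ l : ℝ, HasDerivAt (fun l : ℝ => wv (a / z * l)) (-(a / z * l * (a / z)) / wv (a / z * l)) l := by
    intro l
    have h1 : HasDerivAt (fun l : ℝ => (a / z * l : ℂ)) (a / z) l := by
      simpa using (Complex.ofRealCLM.hasDerivAt (x := l)).const_mul (a / z : ℂ)
    have h2 : HasDerivAt (fun l : ℝ => 1 - (a / z * l : ℂ) ^ 2) (-(2 * (a / z * l) * (a / z))) l := by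
      simpa using (h1.pow 2).const_sub 1
    have h3 := ((h2.clog_real (hsl l)).div_const 2).cexp
    refine h3.congr_deriv ?_
    change wv (a / z * l) * _ = _
    have hs := wv_sq (hsl l)
    rw [← hs]
    have := hwne l
    field_simp
  have hpd : ∀ l ∈ Set.uIcc (0:ℝ) 1, HasDerivAt (fun l : ℝ => Complex.log (Complex.I * (a / z * l) + wv (a / z * l)))
      (Complex.I * a * (1 / z * (1 / wv (a / z * l)))) l := by
    intro l _
    have h1 : HasDerivAt (fun l : ℝ => (a / z * l : ℂ)) (a / z) l := by
      simpa using (Complex.ofRealCLM.hasDerivAt (x := l)).const_mul (a / z : ℂ)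
    have hp := p_re (hsl l)
    have h2 := (((h1.const_mul Complex.I).add (hwd l))).clog_real (Or.inl hp)
    refine h2.congr_deriv ?_
    have hpne : Complex.I * (a / z * l) + wv (a / z * l) ≠ 0 := fun h => by
      rw [h] at hp; simp at hp
    have hw := hwne l
    change (Complex.I * (a / z) + -(a / z * l * (a / z)) / wv (a / z * l)) /
      (Complex.I * (a / z * l) + wv (a / z * l)) = _
    rw [div_eq_iff hpne]
    generalize wv (a / z * l) = W at *
    have hI := Complex.I_sq
    field_simp
    linear_combination (-(a * l : ℂ)) * hI
  have hcont : Continuous fun l : ℝ => Complex.I * a * (1 / z * (1 / wv (a / z * l))) := by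
    have : Continuous fun l : ℝ => wv (a / z * l) :=
      continuous_iff_continuousAt.2 fun l => (hwd l).continuousAt
    exact continuous_const.mul (continuous_const.mul (continuous_const.div this hwne))
  have hF := intervalIntegral.integral_eq_sub_of_hasDerivAt hpd (hcont.intervalIntegrable _ _)
  rw [intervalIntegral.integral_const_mul] at hF
  have h0 : wv 0 = 1 := by simp [wv]
  simp only [Complex.ofReal_one, mul_one, Complex.ofReal_zero, mul_zero, h0, zero_add,
    Complex.log_one, sub_zero] at hF
  rw [← hF]
  have : ∀ l : ℝ, 1 / z * (2 * Real.pi / wv (a / z * l)) = 2 * Real.pi * (1 / z * (1 / wv (a / z * l))) := by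
    intro l; ring
  simp_rw [this]
  rw [intervalIntegral.integral_const_mul, Complex.real_smul]
  push_cast
  have hI := Complex.I_sq
  generalize (∫ (x : ℝ) in (0:ℝ)..1, 1 / z * (1 / wv (a / z * x))) = K
  field_simp
  linear_combination K * hI

lemma exists_law {a : ℝ} (ha : 0 < a) : ∃ μ : Measure ℝ, IsProbabilityMeasure μ ∧
    (∀ᵐ x ∂μ, |x| ≤ a) ∧
    (∀ g : ℝ → ℝ, Continuous g → ∫ x, g (-x) ∂μ = ∫ x, g x ∂μ) ∧
    ∀ ε > 0, ∀ t, |∫ x, Qk ε (t - x) ∂μ| ≤ Real.pi / (2 * a) ∧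
      (0 ≤ t → 0 ≤ ∫ x, Qk ε (t - x) ∂μ) := by
  have hpi := Real.pi_pos
  set ν : Measure (ℝ × ℝ) := (volume.restrict (Set.Ioc (0:ℝ) 1)).prod
    (volume.restrict (Set.Ioc 0 (2 * Real.pi))) with hν
  set X : ℝ × ℝ → ℝ := fun p => a * p.1 * Real.cos p.2 with hX
  have hXc : Continuous X := by simp only [hX]; fun_prop
  set μ : Measure ℝ := ENNReal.ofReal (2 * Real.pi)⁻¹ • ν.map X with hμ
  have hform : ∀ (g : ℝ → ℂ), Continuous g → ∫ x, g x ∂μ =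
      (2 * Real.pi : ℝ)⁻¹ • ∫ l in (0:ℝ)..1, ∫ φ in (0:ℝ)..2 * Real.pi, g (a * l * Real.cos φ) := by
    intro g hg
    rw [hμ, integral_smul_measure, ENNReal.toReal_ofReal (by positivity),
      integral_map hXc.aemeasurable hg.aestronglyMeasurable, hν, integral_prod,
      intervalIntegral.integral_of_le (by norm_num)]
    · congr 2; ext l
      rw [intervalIntegral.integral_of_le (by positivity)]
    · rw [Measure.prod_restrict]
      have : IntegrableOn (fun p => g (X p)) (Set.Icc (0:ℝ) 1 ×ˢ Set.Icc 0 (2 * Real.pi))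
          (volume.prod volume) :=
        (hg.comp hXc).continuousOn.integrableOn_compact (isCompact_Icc.prod isCompact_Icc)
      exact this.mono_set (Set.prod_mono Set.Ioc_subset_Icc_self Set.Ioc_subset_Icc_self)
  have hprob : IsProbabilityMeasure μ := by
    constructor
    rw [hμ, Measure.smul_apply, Measure.map_apply hXc.measurable MeasurableSet.univ,
      Set.preimage_univ, hν, ← Set.univ_prod_univ, Measure.prod_prod]
    simp only [Measure.restrict_apply_univ, Real.volume_Ioc, smul_eq_mul, sub_zero,
      ENNReal.ofReal_one, one_mul]
    rw [← ENNReal.ofReal_mul (by positivity), inv_mul_cancel₀ (by positivity), ENNReal.ofReal_one]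
  refine ⟨μ, hprob, ?_, ?_, ?_⟩
  · rw [hμ]
    refine Measure.ae_smul_measure ?_ _
    rw [ae_map_iff hXc.aemeasurable (measurableSet_le (by fun_prop) measurable_const), hν,
      Measure.prod_restrict]
    refine (ae_restrict_iff' (measurableSet_Ioc.prod measurableSet_Ioc)).2 (ae_of_all _ ?_)
    rintro ⟨l, φ⟩ ⟨hl, -⟩
    simp only [hX, abs_mul, abs_of_pos ha]
    simp only [Set.mem_Ioc] at hl
    rw [abs_of_pos hl.1]
    calc a * l * |Real.cos φ| ≤ a * 1 * 1 := by
          gcongr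
          · exact hl.2
          · exact Real.abs_cos_le_one φ
      _ = a := by ring
  · intro g hg
    have h1 := hform (fun x => (g x : ℂ)) (by fun_prop)
    have h2 := hform (fun x => (g (-x) : ℂ)) (by fun_prop)
    have h3 : ∫ x, (g (-x) : ℂ) ∂μ = ∫ x, (g x : ℂ) ∂μ := by
      rw [h1, h2]
      congr 2; ext l
      have hper : Function.Periodic (fun φ => (g (a * l * Real.cos φ) : ℂ)) (2 * Real.pi) := by
        intro φ; simp [Real.cos_add_two_pi]
      have h4 := hper.intervalIntegral_add_eq Real.pi 0
      rw [zero_add] at h4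
      rw [← h4]
      have h5 := intervalIntegral.integral_comp_add_right (a := 0) (b := 2 * Real.pi)
        (fun φ => (g (a * l * Real.cos φ) : ℂ)) Real.pi
      rw [zero_add, add_comm (2 * Real.pi)] at h5
      rw [← h5]
      congr 1; ext φ
      rw [Real.cos_add_pi]; congr 2; ring
    rw [integral_complex_ofReal, integral_complex_ofReal] at h3
    exact_mod_cast h3
  · intro ε hε t
    set z : ℂ := t + ε * Complex.I with hz
    have hzim : 0 < z.im := by simp [hz, hε]
    have hzx : ∀ x : ℝ, z - x ≠ 0 := by
      intro x h
      have := congrArg Complex.im h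
      simp [hz] at this
      exact hε.ne' this
    have hz0 : z ≠ 0 := by rintro h; rw [h] at hzim; simp at hzim
    have hcont : Continuous fun x : ℝ => 1 / (z - x) :=
      continuous_const.div (by fun_prop) hzx
    have hprodInt : Integrable (fun x : ℝ => 1 / (z - x)) μ := by
      refine Integrable.of_bound hcont.aestronglyMeasurable (1 / ε) (ae_of_all _ fun x => ?_)
      rw [norm_div, norm_one]
      gcongr
      have h := Complex.abs_im_le_norm (z - x)
      have h' : (z - x : ℂ).im = ε := by simp [hz]
      rw [h', abs_of_pos hε] at h
      exact h
    have hre : ∫ x, Qk ε (t - x) ∂μ = (∫ x : ℝ, 1 / (z - x) ∂μ).re := by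
      have := Complex.reCLM.integral_comp_comm hprodInt
      simp only [Complex.reCLM_apply] at this
      rw [← this]
      congr 1; ext x
      rw [Qk_eq_re, hz]
      congr 2; push_cast; ring
    have hval := hform _ hcont
    rw [stieltjes ha hzim] at hval
    have hsl : 1 - (a / z : ℂ) ^ 2 ∈ Complex.slitPlane := by
      apply slit
      left
      rw [div_eq_mul_inv, Complex.im_ofReal_mul, Complex.inv_im]
      have := (Complex.normSq_pos.2 hz0).ne'
      have := hzim.ne'
      exact mul_ne_zero ha.ne' (div_ne_zero (neg_ne_zero.2 this) (by assumption))
    have hre2 : ∫ x, Qk ε (t - x) ∂μ = (Complex.I * (a / z) + wv (a / z)).arg / a := by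
      rw [hre, hval]
      have : (-Complex.I / a) * Complex.log (Complex.I * (a / z) + wv (a / z)) =
        (-Complex.I * Complex.log (Complex.I * (a / z) + wv (a / z))) / (a : ℝ) := by ring
      rw [this, Complex.div_ofReal_re]
      simp [Complex.log_im]
    rw [hre2]
    constructor
    · rw [abs_div, abs_of_pos ha]
      have := Complex.abs_arg_le_pi_div_two_iff.2 (p_re hsl).le
      rw [div_le_div_iff₀ ha (by positivity)]
      nlinarith
    · intro ht
      apply div_nonneg _ ha.le
      rw [Complex.arg_nonneg_iff]
      apply p_im hsl
      rw [div_eq_mul_inv, Complex.re_ofReal_mul, Complex.inv_re]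
      have : z.re = t := by simp [hz]
      rw [this]
      exact mul_nonneg ha.le (div_nonneg ht (Complex.normSq_nonneg _))
lemma FT_eq_fourier (b : ℝ → ℝ) (t : ℝ) :
    FT b t = FourierTransform.fourier (fun x : ℝ => (b x : ℂ)) t := by
  rw [Real.fourier_real_eq_integral_exp_smul, FT]
  congr 1; ext x
  rw [smul_eq_mul, mul_comm]
  congr 2; push_cast; ring

lemma exists_bump {δ : ℝ} (hδ : 0 < δ) : ∃ b : ℝ → ℝ, Continuous b ∧ (∀ x, 0 ≤ b x) ∧
    (∀ x y, |x| ≤ |y| → b y ≤ b x) ∧ (∀ x, δ < |x| → b x = 0) ∧ 0 < ∫ x, b x ∧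
    Integrable (FT b) := by
  set b : ℝ → ℝ := fun x => Real.smoothTransition (1 - (x / δ) ^ 2) with hb
  have hsm : ContDiff ℝ (⊤ : ℕ∞) b := by
    simp only [hb]
    exact Real.smoothTransition.contDiff.comp (by fun_prop)
  have hz : ∀ x, δ < |x| → b x = 0 := by
    intro x hx
    apply Real.smoothTransition.zero_of_nonpos
    have : 1 ≤ (x / δ) ^ 2 := by
      rw [div_pow, le_div_iff₀ (by positivity), one_mul, ← sq_abs x]
      gcongr
    linarith
  have hcs : HasCompactSupport b := by
    apply HasCompactSupport.intro (isCompact_Icc (a := -δ) (b := δ))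
    intro x hx
    apply hz
    by_contra h
    exact hx (abs_le.1 (not_lt.1 h))
  have hnn : ∀ x, 0 ≤ b x := fun x => Real.smoothTransition.nonneg _
  refine ⟨b, hsm.continuous, hnn, ?_, hz, ?_, ?_⟩
  · intro x y hxy
    apply Real.smoothTransition.monotone
    rw [div_pow, div_pow, ← sq_abs x, ← sq_abs y]
    gcongr
  · apply hsm.continuous.integral_pos_of_hasCompactSupport_nonneg_nonzero hcs hnn (x := 0)
    simp [hb]
  · have hsm' : ContDiff ℝ (⊤ : ℕ∞) (fun x => (b x : ℂ)) := Complex.ofRealCLM.contDiff.comp hsm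
    have hcs' : HasCompactSupport (fun x => (b x : ℂ)) := hcs.comp_left Complex.ofReal_zero
    set f : SchwartzMap ℝ ℂ := hcs'.toSchwartzMap hsm' with hf
    have h1 : FT b = (FourierTransform.fourier f : SchwartzMap ℝ ℂ) := by
      ext t
      rw [FT_eq_fourier, SchwartzMap.fourier_coe]
      rfl
    rw [h1]
    exact (FourierTransform.fourier f : SchwartzMap ℝ ℂ).integrable

lemma fub {E : Type*} [NormedAddCommGroup E] [NormedSpace ℝ E] [CompleteSpace E] {b : ℝ → ℝ}
    (hbc : Continuous b) (hbi : Integrable b) {μ : Measure ℝ} [IsProbabilityMeasure μ]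
    {h : ℝ → E} (hh : Continuous h) {C : ℝ} (hC : ∀ x, ‖h x‖ ≤ C) :
    ∫ x, (∫ y, b (x - y) ∂μ) • h x = ∫ y, (∫ v, b v • h (v + y)) ∂μ := by
  have hC0 : 0 ≤ C := (norm_nonneg _).trans (hC 0)
  have hm : AEStronglyMeasurable (Function.uncurry fun (y x : ℝ) => b (x - y) • h x)
      (μ.prod volume) := by
    apply Continuous.aestronglyMeasurable
    simp only [Function.uncurry_def]
    fun_prop
  have hbd : ∀ y x : ℝ, ‖b (x - y) • h x‖ ≤ ‖b (x - y)‖ * C := by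
    intro y x
    rw [norm_smul]
    gcongr
    exact hC x
  have hprodInt : Integrable (Function.uncurry fun (y x : ℝ) => b (x - y) • h x)
      (μ.prod volume) := by
    rw [integrable_prod_iff hm]
    have hi : ∀ y : ℝ, Integrable (fun x => ‖b (x - y)‖ * C) := fun y =>
      (hbi.comp_sub_right y).norm.mul_const C
    constructor
    · refine ae_of_all _ fun y => ?_
      refine (hi y).mono' ?_ (ae_of_all _ (hbd y))
      apply Continuous.aestronglyMeasurable
      simp only [Function.uncurry_def]
      fun_prop
    · refine Integrable.of_bound hm.norm.integral_prod_right' (∫ x, ‖b x‖ * C) (ae_of_all _ fun y => ?_)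
      rw [Real.norm_of_nonneg (integral_nonneg fun _ => norm_nonneg _)]
      rw [← integral_sub_right_eq_self (fun x => ‖b x‖ * C) y]
      exact integral_mono_of_nonneg (ae_of_all _ fun _ => norm_nonneg _) (hi y)
        (ae_of_all _ (hbd y))
  have h1 : ∀ x, (∫ y, b (x - y) ∂μ) • h x = ∫ y, b (x - y) • h x ∂μ := fun x =>
    (integral_smul_const _ _).symm
  simp_rw [h1]
  rw [← integral_integral_swap hprodInt]
  congr 1; ext y
  rw [← integral_add_right_eq_self _ y]
  simp

lemma exists_F {δ : ℝ} (hδ : 0 < δ) (hδ4 : δ < 1/4) : ∃ F : ℝ → ℝ, memA F ∧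
    (∀ y, 1/2 - δ < |y| → F y = 0) ∧ 0 < ∫ y, F y ∧
    ∀ ε > 0, ∀ x, |∫ y, F y * Qk ε (x - y)| ≤ Real.pi / (2 * (1/2 - 2 * δ)) * ∫ y, F y ∧
      (0 ≤ x → 0 ≤ ∫ y, F y * Qk ε (x - y)) := by
  obtain ⟨b, hbc, hbn, hbr, hbz, hbpos, hbFT⟩ := exists_bump hδ
  have ha : 0 < 1/2 - 2 * δ := by linarith
  obtain ⟨μ, hμ, hμs, hμsym, hμQ⟩ := exists_law ha
  set a := 1/2 - 2 * δ with hadef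
  have hbi : Integrable b := by
    by_contra h
    rw [integral_undef h] at hbpos
    exact lt_irrefl _ hbpos
  have hbe : ∀ x, b (-x) = b x := fun x => le_antisymm (hbr _ _ (by simp)) (hbr _ _ (by simp))
  have hb0 : ∀ x, ‖b x‖ ≤ b 0 := fun x => by
    rw [Real.norm_of_nonneg (hbn x)]
    exact hbr _ _ (by simp)
  set F : ℝ → ℝ := fun x => ∫ y, b (x - y) ∂μ with hF
  have hFc : Continuous F := by
    refine continuous_of_dominated (bound := fun _ => b 0) ?_ ?_ (integrable_const _) ?_
    · intro x; exact Continuous.aestronglyMeasurable (by fun_prop)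
    · intro x; exact ae_of_all _ fun y => hb0 _
    · exact ae_of_all _ fun y => by fun_prop
  have hFe : ∀ x, F (-x) = F x := by
    intro x
    simp only [hF]
    rw [← hμsym _ (by fun_prop : Continuous fun y => b (x - y))]
    congr 1; ext y
    rw [← hbe]; congr 1; ring
  have hFn : ∀ x, 0 ≤ F x := fun x => integral_nonneg fun y => hbn _
  have hFz : ∀ y, 1/2 - δ < |y| → F y = 0 := by
    intro x hx
    apply integral_eq_zero_of_ae
    filter_upwards [hμs] with y hy
    apply hbz
    have := abs_sub_abs_le_abs_sub x y
    linarith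
  have hFI : ∫ y, F y = ∫ x, b x := by
    have := fub (μ := μ) hbc hbi (h := fun _ => (1:ℝ)) continuous_const (C := 1) (by simp)
    simpa using this
  have hFTm : ∀ t, FT F t = FT b t * ∫ y : ℝ, Complex.exp (-(2 * Real.pi * Complex.I) * t * y) ∂μ := by
    intro t
    have := fub (μ := μ) hbc hbi
      (h := fun x : ℝ => Complex.exp (-(2 * Real.pi * Complex.I) * t * x)) (by fun_prop) (C := 1)
      (fun x => by
        have := norm_e1 (-t) x
        push_cast at this
        rw [show -(2 * Real.pi * Complex.I) * t * x = 2 * Real.pi * Complex.I * -t * x by ring, this])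
    simp only [Complex.real_smul] at this
    unfold FT
    rw [this, ← integral_const_mul]
    congr 1; ext y
    rw [← integral_mul_const]
    congr 1; ext v
    rw [mul_assoc (b v : ℂ), ← Complex.exp_add]
    congr 2; push_cast; ring
  have hFTi : Integrable (FT F) := by
    have h1 : FT F = fun t => FT b t * ∫ y : ℝ, Complex.exp (-(2 * Real.pi * Complex.I) * t * y) ∂μ :=
      funext hFTm
    have hn : ∀ t y : ℝ, ‖Complex.exp (-(2 * Real.pi * Complex.I) * t * y)‖ ≤ 1 := fun t x => by
        have := norm_e1 (-t) x
        push_cast at this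
        rw [show -(2 * Real.pi * Complex.I) * t * x = 2 * Real.pi * Complex.I * -t * x by ring, this]
    rw [h1]
    refine hbFT.mul_bdd (c := 1) ?_ (ae_of_all _ fun t => ?_)
    · apply Continuous.aestronglyMeasurable
      refine continuous_of_dominated (bound := fun _ => 1) ?_ ?_ (integrable_const _) ?_
      · intro x; exact Continuous.aestronglyMeasurable (by fun_prop)
      · intro x; exact ae_of_all _ fun y => hn _ _
      · exact ae_of_all _ fun y => by fun_prop
    · refine (norm_integral_le_of_norm_le (integrable_const (1:ℝ)) (ae_of_all _ (hn t))).trans ?_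
      simp
  refine ⟨F, ⟨hFc, hFe, hFn, ?_, hFTi⟩, hFz, by rw [hFI]; exact hbpos, ?_⟩
  · intro x hx
    apply hFz
    by_contra h
    rw [not_lt, abs_le] at h
    exact hx ⟨by linarith, by linarith⟩
  intro ε hε x
  set H : ℝ → ℝ := fun t => ∫ y, Qk ε (t - y) ∂μ with hH
  have hQc := Qk_continuous hε
  have hHc : Continuous H := by
    refine continuous_of_dominated (bound := fun _ => 1 / ε) ?_ ?_ (integrable_const _) ?_
    · intro x; exact Continuous.aestronglyMeasurable (by fun_prop)
    · intro x; exact ae_of_all _ fun y => Qk_abs_le hε _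
    · exact ae_of_all _ fun y => by fun_prop
  have hHo : ∀ t, H (-t) = - H t := by
    intro t
    simp only [hH]
    rw [← hμsym _ (by fun_prop : Continuous fun y => Qk ε (t - y)), ← integral_neg]
    congr 1; ext y
    rw [← Qk_neg]; congr 1; ring
  have hHb : ∀ t, ‖H t‖ ≤ Real.pi / (2 * a) := fun t => (hμQ ε hε t).1
  have hHn : ∀ t, 0 ≤ t → 0 ≤ H t := fun t => (hμQ ε hε t).2
  have key : ∫ y, F y * Qk ε (x - y) = ∫ v, b v * H (x - v) := by
    have h1 := fub (μ := μ) hbc hbi (h := fun y => Qk ε (x - y)) (by fun_prop) (C := 1 / ε)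
      (fun y => Qk_abs_le hε _)
    simp only [smul_eq_mul] at h1
    rw [show (∫ y, F y * Qk ε (x - y)) = _ from h1]
    have hprodInt : Integrable (Function.uncurry fun (y v : ℝ) => b v * Qk ε (x - (v + y)))
        (μ.prod volume) := by
      have h2 : Integrable (fun p : ℝ × ℝ => (1:ℝ) * b p.2) (μ.prod volume) :=
        (integrable_const (1:ℝ)).mul_prod hbi
      simp only [one_mul] at h2
      refine h2.mul_bdd (c := 1 / ε) ?_ (ae_of_all _ fun p => Qk_abs_le hε _)
      exact Continuous.aestronglyMeasurable (by fun_prop)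
    rw [integral_integral_swap hprodInt]
    congr 1; ext v
    rw [integral_const_mul]
    simp only [hH]
    congr 2; ext y; congr 1; ring
  have hbH : ∀ g : ℝ → ℝ, Integrable (fun t => b (g t)) → Integrable (fun t => b (g t) * H t) :=
    fun g hg => hg.mul_bdd hHc.aestronglyMeasurable (ae_of_all _ hHb)
  constructor
  · rw [key, hFI, mul_comm, ← integral_mul_const, ← Real.norm_eq_abs]
    refine norm_integral_le_of_norm_le (hbi.mul_const _) (ae_of_all _ fun v => ?_)
    rw [norm_mul, Real.norm_of_nonneg (hbn v)]
    exact mul_le_mul_of_nonneg_left (hHb _) (hbn v)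
  · intro hx
    have k1 : ∫ v, b v * H (x - v) = ∫ t, b (x - t) * H t := by
      rw [← integral_sub_left_eq_self _ volume x]
      simp
    have k2 : ∫ t, b (x - t) * H t = - ∫ t, b (x + t) * H t := by
      rw [← integral_neg_eq_self, ← integral_neg]
      congr 1; ext t
      rw [hHo]; simp
    have i1 := hbH (fun t => x - t) (hbi.comp_sub_left x)
    have i2 := hbH (fun t => x + t) (hbi.comp_add_left x)
    have k3 : 0 ≤ ∫ t, (b (x - t) * H t - b (x + t) * H t) := by
      refine integral_nonneg fun t => ?_
      simp only [Pi.zero_apply]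
      rw [← sub_mul]
      rcases le_total 0 t with ht | ht
      · apply mul_nonneg _ (hHn t ht)
        apply sub_nonneg.2 (hbr _ _ _)
        rw [abs_of_nonneg (by linarith : 0 ≤ x + t), abs_le]
        constructor <;> linarith
      · have := hHn (-t) (by linarith)
        rw [hHo] at this
        apply mul_nonneg_of_nonpos_of_nonpos _ (by linarith)
        apply sub_nonpos.2 (hbr _ _ _)
        rw [abs_of_nonneg (by linarith : 0 ≤ x - t), abs_le]
        constructor <;> linarith
    rw [integral_sub i1 i2] at k3
    rw [key, k1]
    linarith

/-- The periodic conjugate Poisson kernel. -/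
noncomputable def ck (ε u : ℝ) : ℝ :=
  (Complex.cot (Real.pi * ((u : ℂ) + ε * Complex.I))).re

lemma mem_ic {ε : ℝ} (hε : 0 < ε) (u : ℝ) :
    ((u : ℂ) + ε * Complex.I) ∈ Complex.integerComplement :=
  UpperHalfPlane.coe_mem_integerComplement ⟨(u : ℂ) + ε * Complex.I, by simpa using hε⟩

lemma ck_continuous {ε : ℝ} (hε : 0 < ε) : Continuous (ck ε) := by
  unfold ck Complex.cot
  apply Complex.continuous_re.comp
  exact Continuous.div (by fun_prop) (by fun_prop) fun u => sin_pi_mul_ne_zero (mem_ic hε u)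

lemma ck_hasSum_Qk {ε : ℝ} (hε : 0 < ε) (u : ℝ) :
    HasSum (fun n : ℕ => Qk ε (u - (n + 1)) + Qk ε (u + (n + 1)))
      (Real.pi * ck ε u - Qk ε u) := by
  have hz := mem_ic hε u
  have h := (summable_cotTerm hz).hasSum
  have h2 := cot_series_rep' hz
  have h3 := Complex.hasSum_re h
  have e1 : (∑' n, cotTerm ((u : ℂ) + ε * Complex.I) n).re = Real.pi * ck ε u - Qk ε u := by
    simp only [cotTerm]
    rw [← h2, Qk_eq_re, ck]
    simp
  rw [e1] at h3
  convert h3 using 2 with n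
  rw [cotTerm, Complex.add_re, Qk_eq_re, Qk_eq_re]
  congr 3 <;> (push_cast; ring)

lemma ck_hasSum_exp {ε : ℝ} (hε : 0 < ε) (u : ℝ) :
    HasSum (fun k : ℤ => -Complex.I * (Int.sign k : ℂ) * Complex.exp (2 * Real.pi * Complex.I * k * u)
      * Real.exp (-(2 * Real.pi * ε) * |(k : ℝ)|)) (ck ε u : ℂ) := by
  have hpi := Real.pi_pos
  set z : UpperHalfPlane := ⟨(u : ℂ) + ε * Complex.I, by simpa using hε⟩ with hz
  set q : ℂ := Complex.exp (2 * Real.pi * Complex.I * z) with hq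
  have hzc : (z : ℂ) = (u : ℂ) + ε * Complex.I := rfl
  have hqn : ‖q‖ < 1 := by
    rw [hq, Complex.norm_exp, hzc, Real.exp_lt_one_iff]
    simp
    positivity
  have hg := (hasSum_geometric_of_norm_lt_one hqn).mul_left q
  set w := q * (1 - q)⁻¹ with hw
  have hgc := (Complex.hasSum_conj'.2 (by simpa using hg) :
    HasSum (fun n : ℕ => (starRingEnd ℂ) (q * q ^ n)) ((starRingEnd ℂ) w))
  have hcot : Complex.cot (Real.pi * z) = -Complex.I - 2 * Complex.I * w := by
    have h := pi_mul_cot_pi_q_exp z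
    rw [← hq, tsum_geometric_of_norm_lt_one hqn] at h
    have h1 : (1 - q) ≠ 0 := by
      intro h0
      rw [← sub_eq_zero.1 h0] at hqn
      simp at hqn
    have hpc : (Real.pi : ℂ) ≠ 0 := by exact_mod_cast hpi.ne'
    apply mul_left_cancel₀ hpc
    rw [h, hw]
    field_simp
    ring
  have hck : (ck ε u : ℂ) = -Complex.I * w + 0 + Complex.I * (starRingEnd ℂ) w := by
    have : ck ε u = 2 * w.im := by
      unfold ck
      rw [← hzc, hcot]; simp
    rw [this]
    apply Complex.ext <;> simp
    ring
  rw [hck]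
  have h1 := hg.mul_left (-Complex.I)
  have h2 := hgc.mul_left Complex.I
  have key := HasSum.of_add_one_of_neg_add_one (f := fun k : ℤ => -Complex.I * (Int.sign k : ℂ) *
    Complex.exp (2 * Real.pi * Complex.I * k * u)
      * Real.exp (-(2 * Real.pi * ε) * |(k : ℝ)|)) (m := -Complex.I * w)
      (m' := Complex.I * (starRingEnd ℂ) w) ?_ ?_
  · simpa using key
  · refine Eq.mpr (congrArg (fun f => HasSum f _) (funext fun n => ?_)) h1
    have s : Int.sign ((n : ℤ) + 1) = 1 := Int.sign_eq_one_of_pos (by omega)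
    have ab : |(((n : ℤ) + 1 : ℤ) : ℝ)| = n + 1 := by
      push_cast; exact abs_of_nonneg (by positivity)
    rw [s, ab, ← pow_succ', hq, ← Complex.exp_nat_mul, Complex.ofReal_exp, mul_assoc,
      ← Complex.exp_add, hzc]
    push_cast
    rw [mul_one]
    congr 2
    linear_combination (-2 * (n + 1) * Real.pi * ε) * Complex.I_sq
  · refine Eq.mpr (congrArg (fun f => HasSum f _) (funext fun n => ?_)) h2
    have s : Int.sign (-((n : ℤ) + 1)) = -1 := Int.sign_eq_neg_one_of_neg (by omega)
    have ab : |((-((n : ℤ) + 1) : ℤ) : ℝ)| = n + 1 := by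
      push_cast; rw [abs_of_nonpos] <;> linarith [(Nat.cast_nonneg n : (0:ℝ) ≤ n)]
    rw [s, ab, ← pow_succ', hq, ← Complex.exp_nat_mul, Complex.ofReal_exp, mul_assoc,
      ← Complex.exp_add, hzc, ← Complex.exp_conj]
    push_cast
    rw [show -Complex.I * -1 = Complex.I by ring]
    congr 2
    simp only [map_mul, map_add, Complex.conj_I, Complex.conj_ofReal, map_natCast, map_one, map_ofNat]
    linear_combination (-2 * (n + 1) * Real.pi * ε) * Complex.I_sq

lemma Qk_nonneg (ε : ℝ) {u : ℝ} (hu : 0 ≤ u) : 0 ≤ Qk ε u := by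
  unfold Qk; positivity

lemma Qk_anti {ε : ℝ} (hε : 0 < ε) {u v : ℝ} (hu : ε ≤ u) (huv : u ≤ v) : Qk ε v ≤ Qk ε u := by
  unfold Qk
  rw [div_le_div_iff₀ (by positivity) (by positivity)]
  have h1 : ε ^ 2 ≤ u * v := by nlinarith
  nlinarith [mul_nonneg (sub_nonneg.2 huv) (sub_nonneg.2 h1)]

lemma ck_bounds {ε δ θ y : ℝ} (hε : 0 < ε) (hεδ : ε < δ) (h0 : 0 ≤ θ) (h1 : θ ≤ 1/2)
    (hy : |y| ≤ 1/2 - δ) :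
    Real.pi * (ck ε (θ - y) + ck ε (θ + y)) ≤ Qk ε (θ - y) + Qk ε (θ + y) ∧
    Qk ε (θ - y) + Qk ε (θ + y) - (Qk ε (1 - θ - y) + Qk ε (1 - θ + y)) ≤
      Real.pi * (ck ε (θ - y) + ck ε (θ + y)) := by
  obtain ⟨hy1, hy2⟩ := abs_le.1 hy
  set A : ℕ → ℝ := fun n => Qk ε ((n + 1) - θ - y) + Qk ε ((n + 1) - θ + y) with hA
  set B : ℕ → ℝ := fun n => Qk ε ((n + 1) + θ - y) + Qk ε ((n + 1) + θ + y) with hB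
  have hs := (ck_hasSum_Qk hε (θ - y)).add (ck_hasSum_Qk hε (θ + y))
  have hs' : HasSum (fun n => B n - A n) (Real.pi * (ck ε (θ - y) + ck ε (θ + y)) -
      (Qk ε (θ - y) + Qk ε (θ + y))) := by
    convert hs using 1
    · ext n
      simp only [hA, hB]
      rw [show θ - y - (n + 1 : ℝ) = -((n + 1) - θ + y) by ring,
        show θ + y - (n + 1 : ℝ) = -((n + 1) - θ - y) by ring, Qk_neg, Qk_neg,
        show θ - y + (n + 1 : ℝ) = (n + 1) + θ - y by ring,
        show θ + y + (n + 1 : ℝ) = (n + 1) + θ + y by ring]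
      ring
    · ring
  have hBA : ∀ n, B n ≤ A n := by
    intro n
    have hn : (0:ℝ) ≤ n := Nat.cast_nonneg n
    exact add_le_add (Qk_anti hε (by linarith) (by linarith))
      (Qk_anti hε (by linarith) (by linarith))
  have hAB : ∀ n, A (n + 1) ≤ B n := by
    intro n
    have hn : (0:ℝ) ≤ n := Nat.cast_nonneg n
    simp only [hA, hB]
    push_cast
    exact add_le_add (Qk_anti hε (by linarith) (by linarith))
      (Qk_anti hε (by linarith) (by linarith))
  have hA0 : ∀ n, 0 ≤ A n := by
    intro n
    have hn : (0:ℝ) ≤ n := Nat.cast_nonneg n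
    exact add_nonneg (Qk_nonneg _ (by linarith)) (Qk_nonneg _ (by linarith))
  have hps : ∀ N, -A 0 ≤ ∑ n ∈ Finset.range N, (B n - A n) := by
    intro N
    have h := Finset.sum_range_sub A N
    have h2 : ∑ n ∈ Finset.range N, (A (n + 1) - A n) ≤ ∑ n ∈ Finset.range N, (B n - A n) :=
      Finset.sum_le_sum fun n _ => by linarith [hAB n]
    linarith [hA0 N]
  have lo := ge_of_tendsto' hs'.tendsto_sum_nat hps
  have hi := hasSum_le (fun n => sub_nonpos.2 (hBA n)) hs' hasSum_zero
  have hAz : A 0 = Qk ε (1 - θ - y) + Qk ε (1 - θ + y) := by simp [hA]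
  rw [hAz] at lo
  constructor <;> linarith

/-- Abel-regularised periodic Hilbert transform. -/
noncomputable def HP (F : ℝ → ℝ) (θ ε : ℝ) : ℂ :=
  ∑' k : ℤ, -Complex.I * (Int.sign k : ℂ) * FT F (1 * k) *
    Complex.exp (2 * Real.pi * Complex.I * k * θ) * Real.exp (-(2 * Real.pi * ε) * |(k : ℝ)|)

lemma norm_isign_le (k : ℤ) : ‖((Int.sign k : ℤ) : ℂ)‖ ≤ 1 := by
  rcases lt_trichotomy k 0 with h | h | h
  · simp [Int.sign_eq_neg_one_of_neg h]
  · simp [h]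
  · simp [Int.sign_eq_one_of_pos h]

lemma norm_term (k : ℤ) (u ε : ℝ) : ‖-Complex.I * (Int.sign k : ℂ) *
    Complex.exp (2 * Real.pi * Complex.I * k * u) * Real.exp (-(2 * Real.pi * ε) * |(k : ℝ)|)‖
    ≤ Real.exp (-(2 * Real.pi * ε) * |(k : ℝ)|) := by
  have h := norm_e1 k u
  push_cast at h
  rw [norm_mul, norm_mul, norm_mul, h, norm_neg, Complex.norm_I, one_mul, mul_one,
    Complex.norm_real, Real.norm_of_nonneg (Real.exp_pos _).le]
  have := norm_isign_le k
  nlinarith [Real.exp_pos (-(2 * Real.pi * ε) * |(k : ℝ)|)]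

lemma summable_exp_int {ε : ℝ} (hε : 0 < ε) :
    Summable (fun k : ℤ => Real.exp (-(2 * Real.pi * ε) * |(k : ℝ)|)) := by
  have h := (ck_hasSum_exp hε 0).summable.norm
  have hs : Summable (fun k : ℤ => if k = 0 then (1:ℝ) else 0) :=
    summable_of_ne_finset_zero (s := {0}) (by intro k hk; simp at hk; simp [hk])
  refine (h.add hs).congr fun k => ?_
  rcases lt_trichotomy k 0 with h | h | h
  · simp [Int.sign_eq_neg_one_of_neg h, h.ne, Complex.norm_exp]
  · simp [h]
  · simp [Int.sign_eq_one_of_pos h, h.ne', Complex.norm_exp]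

lemma HP_eq {F : ℝ → ℝ} (hF : Integrable F) {ε : ℝ} (hε : 0 < ε) (θ : ℝ) :
    HP F θ ε = ((∫ y, F y * ck ε (θ - y) : ℝ) : ℂ) := by
  set t : ℤ → ℝ → ℂ := fun k u => -Complex.I * (Int.sign k : ℂ) *
    Complex.exp (2 * Real.pi * Complex.I * k * u) * Real.exp (-(2 * Real.pi * ε) * |(k : ℝ)|) with ht
  have hFc : Integrable (fun y => (F y : ℂ)) := hF.ofReal
  have htc : ∀ k, Continuous fun y => t k (θ - y) := fun k => by
    simp only [ht]; fun_prop
  have hi : ∀ k, Integrable (fun y => (F y : ℂ) * t k (θ - y)) := fun k =>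
    hFc.mul_bdd (htc k).aestronglyMeasurable (ae_of_all _ fun y => norm_term k _ ε)
  have hsum : Summable fun k => ∫ y, ‖(F y : ℂ) * t k (θ - y)‖ := by
    refine Summable.of_nonneg_of_le (fun k => integral_nonneg fun _ => norm_nonneg _) (fun k => ?_)
      ((summable_exp_int hε).mul_left (∫ y, ‖(F y : ℂ)‖))
    rw [← integral_mul_const]
    refine integral_mono (hi k).norm (hFc.norm.mul_const _) fun y => ?_
    simp only [norm_mul (F y : ℂ)]
    exact mul_le_mul_of_nonneg_left (norm_term k _ ε) (norm_nonneg _)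
  have h := MeasureTheory.hasSum_integral_of_summable_integral_norm hi hsum
  have e1 : ∫ y, ∑' k, (F y : ℂ) * t k (θ - y) = ((∫ y, F y * ck ε (θ - y) : ℝ) : ℂ) := by
    rw [← integral_complex_ofReal]
    congr 1; ext y
    rw [((ck_hasSum_exp hε (θ - y)).mul_left (F y : ℂ)).tsum_eq]
    push_cast; rfl
  rw [← e1, ← h.tsum_eq]
  unfold HP
  congr 1; ext k
  have e2 : ∀ y : ℝ, (F y : ℂ) * t k (θ - y) = (-Complex.I * (Int.sign k : ℂ) *
      Complex.exp (2 * Real.pi * Complex.I * k * θ) * Real.exp (-(2 * Real.pi * ε) * |(k : ℝ)|)) *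
      ((F y : ℂ) * Complex.exp (-(2 * Real.pi * Complex.I) * (1 * k : ℝ) * y)) := by
    intro y
    simp only [ht]
    rw [show 2 * Real.pi * Complex.I * k * ((θ - y : ℝ) : ℂ) = 2 * Real.pi * Complex.I * k * θ +
      -(2 * Real.pi * Complex.I) * ((1 * k : ℝ) : ℂ) * y by push_cast; ring, Complex.exp_add]
    ring
  simp_rw [e2]
  rw [integral_const_mul, FT]
  ring

lemma HP_tendsto {F : ℝ → ℝ} {θ : ℝ} (hs : Summable fun k : ℤ => -Complex.I * (Int.sign k : ℂ) *
    FT F (1 * k) * Complex.exp (2 * Real.pi * Complex.I * k * θ)) :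
    Tendsto (fun ε => HP F θ ε) (𝓝[>] 0) (𝓝 (HilbPer F 1 θ)) := by
  unfold HP HilbPer
  refine tendsto_tsum_of_dominated_convergence hs.norm (fun k => ?_) ?_
  · apply tendsto_nhdsWithin_of_tendsto_nhds
    have : Continuous fun ε : ℝ => -Complex.I * (Int.sign k : ℂ) *
      FT F (1 * k) * Complex.exp (2 * Real.pi * Complex.I * k * θ) *
      Real.exp (-(2 * Real.pi * ε) * |(k : ℝ)|) := by fun_prop
    have h := this.tendsto 0
    simpa using h
  · filter_upwards [self_mem_nhdsWithin] with ε hε k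
    rw [norm_mul _ (Complex.ofReal _), Complex.norm_real, Real.norm_of_nonneg (Real.exp_pos _).le]
    apply mul_le_of_le_one_right (norm_nonneg _)
    rw [Real.exp_le_one_iff]
    have : (0:ℝ) < ε := hε
    have := Real.pi_pos
    have : 0 ≤ (2 * Real.pi * ε) * |(k : ℝ)| := by positivity
    linarith

lemma HilbPer_sub_int (F : ℝ → ℝ) (θ : ℝ) (n : ℤ) : HilbPer F 1 (θ - n) = HilbPer F 1 θ := by
  unfold HilbPer
  congr 1; ext k
  congr 1
  rw [Complex.exp_eq_exp_iff_exists_int]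
  exact ⟨-(k * n), by push_cast; ring⟩

lemma FT_neg {F : ℝ → ℝ} (hF : ∀ x, F (-x) = F x) (t : ℝ) : FT F (-t) = FT F t := by
  unfold FT
  rw [← integral_neg_eq_self]
  congr 1; ext x
  rw [hF]; push_cast; congr 2; ring

lemma HilbPer_neg {F : ℝ → ℝ} (hF : ∀ x, F (-x) = F x) (θ : ℝ) :
    HilbPer F 1 (-θ) = - HilbPer F 1 θ := by
  unfold HilbPer
  rw [← tsum_neg, ← (Equiv.neg ℤ).tsum_eq]
  congr 1; ext k
  simp only [Equiv.neg_apply, Int.sign_neg]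
  have := FT_neg hF (1 * k)
  rw [show (1 * ((-k : ℤ) : ℝ)) = -(1 * k) by push_cast; ring, this]
  push_cast
  rw [show 2 * Real.pi * Complex.I * -(k : ℂ) * -θ = 2 * Real.pi * Complex.I * k * θ by ring]
  ring

lemma upper {δ : ℝ} (hδ : 0 < δ) (hδ4 : δ < 1/4) : ∃ F : ℝ → ℝ, memA F ∧ 0 < ∫ y, F y ∧
    max (supHR F) (supHPer F 1) ≤ (∫ y, F y) / (1 - 4 * δ) := by
  have hpi := Real.pi_pos
  obtain ⟨F, hF, hFz, hpos, hQ⟩ := exists_F hδ hδ4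
  obtain ⟨hFc, hFe, hFn, -, hFT⟩ := id hF
  have hFi : Integrable F := by
    by_contra h
    rw [integral_undef h] at hpos
    exact lt_irrefl _ hpos
  have h4 : 0 < 1 - 4 * δ := by linarith
  set B := (∫ y, F y) / (1 - 4 * δ) with hB
  have hB0 : 0 ≤ B := by positivity
  have hπB : Real.pi / (2 * (1/2 - 2 * δ)) * ∫ y, F y = Real.pi * B := by
    rw [hB, show 2 * (1/2 - 2 * δ) = 1 - 4 * δ by ring]; ring
  simp only [hπB] at hQ
  refine ⟨F, hF, hpos, max_le (ciSup_le fun x => ?_) (ciSup_le fun θ => ?_)⟩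
  · have ht := HA_tendsto (F := F) (x := x) (xs := fun _ => x) (es := fun ε => ε) (l := 𝓝[>] (0:ℝ)) hFT
      tendsto_const_nhds (tendsto_nhdsWithin_of_tendsto_nhds tendsto_id)
      (by filter_upwards [self_mem_nhdsWithin] with ε hε using le_of_lt hε)
    refine le_of_tendsto ht.norm ?_
    filter_upwards [self_mem_nhdsWithin] with ε hε
    rw [HA_eq hFi hε, Complex.norm_real, Real.norm_eq_abs]
    have h := (hQ ε hε x).1
    have : ∫ y, F y * (Qk ε (x - y) / Real.pi) = (∫ y, F y * Qk ε (x - y)) / Real.pi := by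
      rw [← integral_div]; congr 1; ext y; ring
    rw [this, abs_div, abs_of_pos hpi, div_le_iff₀ hpi]
    linarith
  · set θ' := |θ - round θ| with hθ'
    have h0 : 0 ≤ θ' := abs_nonneg _
    have h1 : θ' ≤ 1/2 := abs_sub_round θ
    have hn : ‖HilbPer F 1 θ‖ = ‖HilbPer F 1 θ'‖ := by
      rw [← HilbPer_sub_int F θ (round θ), hθ']
      rcases abs_choice (θ - round θ) with h | h
      · rw [h]
      · rw [h, HilbPer_neg hFe, norm_neg]
    rw [hn]
    by_cases hs : Summable fun k : ℤ => -Complex.I * (Int.sign k : ℂ) *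
      FT F (1 * k) * Complex.exp (2 * Real.pi * Complex.I * k * θ')
    swap
    · rw [HilbPer, tsum_eq_zero_of_not_summable hs, norm_zero]; exact hB0
    refine le_of_tendsto (HP_tendsto hs).norm ?_
    filter_upwards [Ioo_mem_nhdsGT hδ] with ε hε
    obtain ⟨hε, hεδ⟩ := hε
    rw [HP_eq hFi hε, Complex.norm_real, Real.norm_eq_abs]
    have hcs : HasCompactSupport F := by
      apply HasCompactSupport.intro (isCompact_Icc (a := -(1/2 - δ)) (b := 1/2 - δ))
      intro x hx
      apply hFz
      by_contra h
      exact hx (abs_le.1 (not_lt.1 h))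
    have hii : ∀ g : ℝ → ℝ, Continuous g → Integrable fun y => F y * g y := fun g hg =>
      (hFc.mul hg).integrable_of_hasCompactSupport hcs.mul_right
    have hrefl : ∀ g : ℝ → ℝ, ∀ x, ∫ y, F y * g (x + y) = ∫ y, F y * g (x - y) := by
      intro g x
      rw [← integral_neg_eq_self]
      congr 1; ext y
      rw [hFe]; rfl
    have hcc := ck_continuous hε
    have hqc := Qk_continuous hε
    have j1 := hii (fun y => ck ε (θ' - y)) (by fun_prop)
    have j2 := hii (fun y => ck ε (θ' + y)) (by fun_prop)
    have j3 := hii (fun y => Qk ε (θ' - y)) (by fun_prop)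
    have j4 := hii (fun y => Qk ε (θ' + y)) (by fun_prop)
    have j5 := hii (fun y => Qk ε (1 - θ' - y)) (by fun_prop)
    have j6 := hii (fun y => Qk ε (1 - θ' + y)) (by fun_prop)
    have up : ∫ y, Real.pi * (F y * ck ε (θ' - y) + F y * ck ε (θ' + y)) ≤
        ∫ y, (F y * Qk ε (θ' - y) + F y * Qk ε (θ' + y)) := by
      refine integral_mono ((j1.add j2).const_mul _) (j3.add j4) fun y => ?_
      rcases lt_or_ge (1/2 - δ) |y| with h | h
      · simp [hFz y h]
      · have := mul_le_mul_of_nonneg_left (ck_bounds hε hεδ h0 h1 h).1 (hFn y)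
        simp only
        linarith
    have lo : ∫ y, ((F y * Qk ε (θ' - y) + F y * Qk ε (θ' + y)) -
        (F y * Qk ε (1 - θ' - y) + F y * Qk ε (1 - θ' + y))) ≤
        ∫ y, Real.pi * (F y * ck ε (θ' - y) + F y * ck ε (θ' + y)) := by
      refine integral_mono ((j3.add j4).sub (j5.add j6)) ((j1.add j2).const_mul _) fun y => ?_
      rcases lt_or_ge (1/2 - δ) |y| with h | h
      · simp [hFz y h]
      · have := mul_le_mul_of_nonneg_left (ck_bounds hε hεδ h0 h1 h).2 (hFn y)
        simp only
        linarith
    have s1 : ∫ y, Real.pi * (F y * ck ε (θ' - y) + F y * ck ε (θ' + y)) =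
        2 * (Real.pi * ∫ y, F y * ck ε (θ' - y)) := by
      rw [integral_const_mul, integral_add j1 j2, hrefl (ck ε)]; ring
    have s2 : ∫ y, (F y * Qk ε (θ' - y) + F y * Qk ε (θ' + y)) =
        2 * ∫ y, F y * Qk ε (θ' - y) := by
      rw [integral_add j3 j4, hrefl (Qk ε)]; ring
    have s3 : ∫ y, ((F y * Qk ε (θ' - y) + F y * Qk ε (θ' + y)) -
        (F y * Qk ε (1 - θ' - y) + F y * Qk ε (1 - θ' + y))) =
        2 * (∫ y, F y * Qk ε (θ' - y)) - 2 * ∫ y, F y * Qk ε (1 - θ' - y) := by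
      rw [integral_sub, s2, integral_add j5 j6, hrefl (Qk ε) (1 - θ')]
      · ring
      · exact j3.add j4
      · exact j5.add j6
    rw [s1, s2] at up
    rw [s3, s1] at lo
    have b1 := (hQ ε hε θ').2 h0
    have b2 := (abs_le.1 (hQ ε hε θ').1).2
    have b3 := (abs_le.1 (hQ ε hε (1 - θ')).1).2
    rw [abs_le]
    constructor
    · refine le_of_mul_le_mul_left ?_ hpi
      linarith
    · refine le_of_mul_le_mul_left ?_ hpi
      linarith

lemma integral_pos_of_memA {F : ℝ → ℝ} (hF : memA F) (h0 : F ≠ 0) : 0 < ∫ y, F y := by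
  obtain ⟨hFc, hFe, hFn, hz, hFT⟩ := hF
  obtain ⟨x, hx⟩ := Function.ne_iff.1 h0
  exact hFc.integral_pos_of_hasCompactSupport_nonneg_nonzero
    (HasCompactSupport.intro isCompact_Icc hz) hFn hx

/-- Extremal Problem 1: the infimum of `𝒞(F)/‖F‖₁` over nonzero `F ∈ 𝒜` equals `1`. -/
theorem stmt2 :
    sInf {r : ℝ | ∃ F : ℝ → ℝ, memA F ∧ F ≠ 0 ∧
      r = max (supHR F) (supHPer F 1) / ∫ x : ℝ, |F x|} = 1 := by
  have habs : ∀ F : ℝ → ℝ, memA F → ∫ x : ℝ, |F x| = ∫ x, F x := fun F hF => by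
    congr 1; ext x; exact abs_of_nonneg (hF.2.2.1 x)
  have hlow : ∀ r ∈ {r : ℝ | ∃ F : ℝ → ℝ, memA F ∧ F ≠ 0 ∧
      r = max (supHR F) (supHPer F 1) / ∫ x : ℝ, |F x|}, 1 ≤ r := by
    rintro r ⟨F, hF, h0, rfl⟩
    rw [habs F hF, le_div_iff₀ (integral_pos_of_memA hF h0), one_mul]
    exact (lower hF).trans (le_max_left _ _)
  have hup : ∀ δ : ℝ, 0 < δ → δ < 1/4 → ∃ r ∈ {r : ℝ | ∃ F : ℝ → ℝ, memA F ∧ F ≠ 0 ∧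
      r = max (supHR F) (supHPer F 1) / ∫ x : ℝ, |F x|}, r ≤ 1 / (1 - 4 * δ) := by
    intro δ h1 h2
    obtain ⟨F, hF, hpos, hle⟩ := upper h1 h2
    refine ⟨_, ⟨F, hF, ?_, rfl⟩, ?_⟩
    · rintro rfl
      simp at hpos
    · rw [habs F hF, div_le_iff₀ hpos]
      refine hle.trans (le_of_eq ?_)
      ring
  apply le_antisymm
  · have ht : Tendsto (fun δ : ℝ => 1 / (1 - 4 * δ)) (𝓝[>] 0) (𝓝 1) := by
      apply tendsto_nhdsWithin_of_tendsto_nhds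
      have : ContinuousAt (fun δ : ℝ => 1 / (1 - 4 * δ)) 0 := by
        apply ContinuousAt.div <;> first | fun_prop | norm_num
      simpa [ContinuousAt] using this
    refine ge_of_tendsto ht ?_
    filter_upwards [Ioo_mem_nhdsGT (show (0:ℝ) < 1/4 by norm_num)] with δ hδ
    obtain ⟨r, hr, hle⟩ := hup δ hδ.1 hδ.2
    exact (csInf_le ⟨1, hlow⟩ hr).trans hle
  · obtain ⟨r, hr, -⟩ := hup (1/8) (by norm_num) (by norm_num)
    exact le_csInf ⟨r, hr⟩ hlow
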